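/- Let I ⊆ S be a squarefree monomial ideal with minimal primary decomposition I = I_{α_1} ∩ ⋯ ∩ I_{α_r}. Let e ≥ 1, q = p^e, and let γ ∈ ℕ^n with γ_i ∈ {0, p−1, p} for all i; define γ_e ∈ ℕ^n by replacing every entry of γ equal to p−1 by q−1 and every entry equal to p by q (entries 0 stay 0). Then x^γ is a minimal monomial generator of (I^{[p]} :_S I) if and only if x^{γ_e} is a minimal monomial generator of (I^{[q]} :_S I); in particular this gives a bijective correspondence between the minimal monomial generators of (I^{[p]} :_S I) and those of (I^{[q]} :_S I). -/

import Mathlib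

noncomputable section

/-- The `q`-th Frobenius power of an ideal: the ideal generated by `{f^q : f ∈ I}`. -/
def frobPow {R : Type*} [CommRing R] (q : ℕ) (I : Ideal R) : Ideal R :=
  Ideal.span ((fun f => f ^ q) '' (I : Set R))

/-- The monomial `x^γ = x_1^{γ_1} ⋯ x_n^{γ_n}` in `k[[x_1,…,x_n]]`. -/
def mon (k : Type*) [Field k] {n : ℕ} (γ : Fin n → ℕ) : MvPowerSeries (Fin n) k :=
  ∏ i, (MvPowerSeries.X i : MvPowerSeries (Fin n) k) ^ γ i

/-- The face ideal `I_α`, generated by the variables `x_i` with `α i = 1`. -/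
def faceIdeal (k : Type*) [Field k] {n : ℕ} (α : Fin n → ℕ) :
    Ideal (MvPowerSeries (Fin n) k) :=
  Ideal.span {f | ∃ i, α i = 1 ∧ f = MvPowerSeries.X i}

/-- `I = I_{α_1} ∩ ⋯ ∩ I_{α_r}` is the minimal primary decomposition of the squarefree
monomial ideal `I` into face ideals: each `α j` is a nonzero `{0,1}`-vector, `I` is the
intersection of the face ideals `I_{α j}`, and the decomposition is irredundant (the
supports of the `α j` are pairwise incomparable). -/
def IsMinFaceDecomp (k : Type*) [Field k] {n r : ℕ} (α : Fin r → Fin n → ℕ)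
    (I : Ideal (MvPowerSeries (Fin n) k)) : Prop :=
  (∀ j i, α j i = 0 ∨ α j i = 1) ∧ (∀ j, α j ≠ 0) ∧
    I = ⨅ j, faceIdeal k (α j) ∧
    ∀ j l, j ≠ l → ¬ ({i | α j i = 1} ⊆ {i | α l i = 1})

/-- `x^γ` is a minimal monomial generator of the monomial ideal `J`: `x^γ ∈ J` and no
monomial properly dividing `x^γ` belongs to `J`. -/
def IsMinGen (k : Type*) [Field k] {n : ℕ} (J : Ideal (MvPowerSeries (Fin n) k))
    (γ : Fin n → ℕ) : Prop :=
  mon k γ ∈ J ∧ ∀ δ : Fin n → ℕ, (∀ i, δ i ≤ γ i) → δ ≠ γ → mon k δ ∉ J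

/-- Replace each entry of `γ` equal to `p` by `q`, each entry equal to `p - 1` by `q - 1`,
and keep the remaining (zero) entries equal to `0`. -/
def scaleExp {n : ℕ} (p q : ℕ) (γ : Fin n → ℕ) : Fin n → ℕ :=
  fun i => if γ i = p then q else if γ i = p - 1 then q - 1 else 0

open MvPowerSeries

/-- A finset of indices that meets the support of every `α j`. -/
def Hits {n r : ℕ} (α : Fin r → Fin n → ℕ) (D : Finset (Fin n)) : Prop :=
  ∀ j, ∃ i, α j i = 1 ∧ i ∈ D

/-- The ideal of power series all of whose exponents satisfy the upward closed condition `P`. -/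
def exponentIdeal (k : Type*) [Field k] {n : ℕ} (P : (Fin n →₀ ℕ) → Prop)
    (hP : ∀ a b, P a → P (a + b)) : Ideal (MvPowerSeries (Fin n) k) where
  carrier := {f | ∀ m, ¬ P m → coeff m f = 0}
  add_mem' := fun {a b} ha hb m hm => by simp [ha m hm, hb m hm]
  zero_mem' := fun m _ => by simp
  smul_mem' := fun c f hf m hm => by
    classical
    rw [smul_eq_mul, coeff_mul]
    refine Finset.sum_eq_zero fun x hx => ?_
    rw [hf x.2 (fun h => hm ?_), mul_zero]
    rw [← Finset.HasAntidiagonal.mem_antidiagonal.mp hx, add_comm]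
    exact hP _ _ h

section Monomials

variable {k : Type*} [Field k] {n : ℕ}

lemma mon_eq_monomial (γ : Fin n → ℕ) :
    mon k γ = monomial (Finsupp.equivFunOnFinite.symm γ) (1 : k) := by
  have h : Finsupp.equivFunOnFinite.symm γ = ∑ i, Finsupp.single i (γ i) := by
    ext j
    simp [Finsupp.finsetSum_apply, Finsupp.single_apply]
  rw [mon, h]
  simp only [X_pow_eq]
  induction (Finset.univ : Finset (Fin n)) using Finset.cons_induction with
  | empty => simp
  | cons a s ha ih => rw [Finset.prod_cons, Finset.sum_cons, ih, monomial_mul_monomial, one_mul]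

lemma mon_add (γ δ : Fin n → ℕ) : mon k (γ + δ) = mon k γ * mon k δ := by
  simp [mon, pow_add, Finset.prod_mul_distrib]

lemma mon_pow (γ : Fin n → ℕ) (q : ℕ) : mon k γ ^ q = mon k (q • γ) := by
  simp [mon, ← Finset.prod_pow, ← pow_mul, mul_comm]

lemma mon_dvd {γ δ : Fin n → ℕ} (h : γ ≤ δ) : mon k γ ∣ mon k δ :=
  ⟨mon k (δ - γ), by rw [← mon_add, add_tsub_cancel_of_le h]⟩

lemma mon_mem_exponentIdeal {P : (Fin n →₀ ℕ) → Prop} {hP : ∀ a b, P a → P (a + b)}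
    {γ : Fin n → ℕ} :
    mon k γ ∈ exponentIdeal k P hP ↔ P (Finsupp.equivFunOnFinite.symm γ) := by
  classical
  rw [mon_eq_monomial]
  constructor
  · intro h
    by_contra hc
    simpa using h _ hc
  · intro h m hm
    rw [coeff_monomial, if_neg]
    rintro rfl
    exact hm h

/-- The exponent vector of the squarefree monomial with support `B`. -/
def indicatorExp (B : Finset (Fin n)) : Fin n → ℕ := fun i => if i ∈ B then 1 else 0

variable {r : ℕ} {α : Fin r → Fin n → ℕ}

lemma iInf_faceIdeal_le_exponentIdeal :
    (⨅ j, faceIdeal k (α j)) ≤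
      exponentIdeal k (fun m => Hits α m.support) (fun a b h j => by
        obtain ⟨i, hi, hs⟩ := h j
        refine ⟨i, hi, ?_⟩
        simp only [Finsupp.mem_support_iff, Finsupp.add_apply] at hs ⊢
        omega) := by
  intro f hf m hm
  simp only [Hits, not_forall, not_exists, not_and] at hm
  obtain ⟨j, hj⟩ := hm
  have h1 : faceIdeal k (α j) ≤ exponentIdeal k (fun m => ∃ i, α j i = 1 ∧ i ∈ m.support)
      (fun a b ⟨i, hi, hs⟩ => by
        refine ⟨i, hi, ?_⟩
        simp only [Finsupp.mem_support_iff, Finsupp.add_apply] at hs ⊢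
        omega) := by
    rw [faceIdeal, Ideal.span_le]
    rintro _ ⟨i, hi, rfl⟩ m hm
    classical
    rw [coeff_X, if_neg]
    rintro rfl
    exact hm ⟨i, hi, by simp⟩
  exact h1 ((Submodule.mem_iInf _).mp hf j) m fun ⟨i, hi, hs⟩ => hj i hi hs

lemma exponentIdeal_le_span_mon (hP : ∀ a b : Fin n →₀ ℕ, Hits α a.support →
    Hits α (a + b).support) :
    exponentIdeal k (fun m => Hits α m.support) hP ≤
      Ideal.span ((fun B => mon k (indicatorExp B)) '' {B | Hits α B}) := by
  classical
  intro f hf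
  let g : Finset (Fin n) → MvPowerSeries (Fin n) k := fun B m =>
    if m.support ⊆ B then coeff (m + Finsupp.equivFunOnFinite.symm (indicatorExp B)) f else 0
  have key : f = ∑ B ∈ Finset.univ.filter (Hits α), mon k (indicatorExp B) * g B := by
    ext m
    rw [map_sum]
    have hterm : ∀ B, coeff m (mon k (indicatorExp B) * g B) =
        if m.support = B then coeff m f else 0 := by
      intro B
      rw [mon_eq_monomial, coeff_monomial_mul, one_mul]
      by_cases hB : m.support = B
      · have hle : Finsupp.equivFunOnFinite.symm (indicatorExp B) ≤ m := by
          intro i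
          by_cases hi : i ∈ B
          · have : m i ≠ 0 := by rw [← hB] at hi; simpa using hi
            simp [indicatorExp, hi]
            omega
          · simp [indicatorExp, hi]
        rw [if_pos hB, if_pos hle]
        change (if _ then _ else _) = _
        rw [if_pos, tsub_add_cancel_of_le hle]
        rw [← hB]
        intro i hi
        simp only [Finsupp.mem_support_iff, Finsupp.tsub_apply] at hi ⊢
        omega
      · rw [if_neg hB]
        split_ifs with hle
        · change (if _ then _ else _) = _
          rw [if_neg]
          intro hsub
          apply hB
          ext i
          have h1 := hle i
          have h2 := @hsub i
          simp only [Finsupp.mem_support_iff, Finsupp.tsub_apply,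
            Finsupp.equivFunOnFinite_symm_apply_apply, indicatorExp] at h1 h2 ⊢
          by_cases hi : i ∈ B
          · simp only [hi, if_true] at h1 ⊢
            simp only [ne_eq, iff_true]
            omega
          · simp only [hi, if_false] at h2 ⊢
            simpa using h2
        · rfl
    simp only [hterm]
    rw [Finset.sum_ite_eq]
    split_ifs with h
    · rfl
    · exact hf m (by simpa using h)
  rw [key]
  refine Ideal.sum_mem _ fun B hB => Ideal.mul_mem_right _ _ (Ideal.subset_span ⟨B, ?_, rfl⟩)
  simpa using hB

lemma iInf_faceIdeal_eq_span :
    (⨅ j, faceIdeal k (α j)) =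
      Ideal.span ((fun B => mon k (indicatorExp B)) '' {B | Hits α B}) := by
  refine le_antisymm (iInf_faceIdeal_le_exponentIdeal.trans (exponentIdeal_le_span_mon _)) ?_
  rw [Ideal.span_le]
  rintro _ ⟨B, hB, rfl⟩
  refine (Submodule.mem_iInf _).mpr fun j => ?_
  obtain ⟨i, hi, hiB⟩ := hB j
  refine Ideal.mem_of_dvd _ ?_ (Ideal.subset_span ⟨i, hi, rfl⟩)
  have h : (X i : MvPowerSeries (Fin n) k) ^ indicatorExp B i ∣ mon k (indicatorExp B) :=
    Finset.dvd_prod_of_mem _ (Finset.mem_univ i)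
  rwa [indicatorExp, if_pos hiB, pow_one] at h

variable (p : ℕ) [Fact p.Prime] [CharP k p]

lemma frobPow_iInf_faceIdeal_eq_span (e : ℕ) :
    frobPow (p ^ e) (⨅ j, faceIdeal k (α j)) =
      Ideal.span ((fun B => mon k (p ^ e • indicatorExp B)) '' {B | Hits α B}) := by
  have : CharP (MvPowerSeries (Fin n) k) p :=
    charP_of_injective_algebraMap (FaithfulSMul.algebraMap_injective k _) p
  have h : frobPow (p ^ e) (⨅ j, faceIdeal k (α j)) =
      (⨅ j, faceIdeal k (α j)).map (iterateFrobenius (MvPowerSeries (Fin n) k) p e) := rfl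
  rw [h, iInf_faceIdeal_eq_span, Ideal.map_span, Set.image_image]
  simp only [iterateFrobenius_def, mon_pow]

lemma mon_mem_frobPow_iff (e : ℕ) (δ : Fin n → ℕ) :
    mon k δ ∈ frobPow (p ^ e) (⨅ j, faceIdeal k (α j)) ↔
      Hits α (Finset.univ.filter fun i => p ^ e ≤ δ i) := by
  rw [frobPow_iInf_faceIdeal_eq_span]
  constructor
  · intro h
    have hle : Ideal.span ((fun B => mon k (p ^ e • indicatorExp B)) '' {B | Hits α B}) ≤
        exponentIdeal k (fun m => Hits α (Finset.univ.filter fun i => p ^ e ≤ m i))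
          (fun a b h j => by
            obtain ⟨i, hi, hs⟩ := h j
            refine ⟨i, hi, ?_⟩
            rw [Finset.mem_filter_univ] at hs ⊢
            exact hs.trans (Nat.le_add_right _ _)) := by
      rw [Ideal.span_le]
      rintro _ ⟨B, hB, rfl⟩
      refine mon_mem_exponentIdeal.mpr fun j => ?_
      obtain ⟨i, hi, hs⟩ := hB j
      exact ⟨i, hi, by simp [indicatorExp, hs]⟩
    simpa using mon_mem_exponentIdeal.mp (hle h)
  · intro h
    refine Ideal.mem_of_dvd _ (mon_dvd fun i => ?_) (Ideal.subset_span ⟨_, h, rfl⟩)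
    by_cases hi : p ^ e ≤ δ i <;> simp [indicatorExp, hi]

lemma mon_mem_colon_iff (e : ℕ) (γ : Fin n → ℕ) :
    mon k γ ∈ (frobPow (p ^ e) (⨅ j, faceIdeal k (α j))).colon
        (⨅ j, faceIdeal k (α j) : Ideal (MvPowerSeries (Fin n) k)) ↔
      ∀ B, Hits α B →
        Hits α (Finset.univ.filter fun i => p ^ e ≤ γ i + indicatorExp B i) := by
  have h (B : Finset (Fin n)) := mon_mem_frobPow_iff (k := k) (α := α) p e (γ + indicatorExp B)
  simp only [Pi.add_apply, mon_add] at h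
  simp only [← h]
  rw [Submodule.mem_colon]
  constructor
  · intro H B hB
    refine H _ ?_
    rw [iInf_faceIdeal_eq_span]
    exact Ideal.subset_span ⟨B, hB, rfl⟩
  · intro H
    suffices (⨅ j, faceIdeal k (α j)) ≤
        Submodule.comap (LinearMap.mulLeft (MvPowerSeries (Fin n) k) (mon k γ))
          (frobPow (p ^ e) (⨅ j, faceIdeal k (α j))) from
      fun f hf => this hf
    conv_lhs => rw [iInf_faceIdeal_eq_span]
    refine Submodule.span_le.mpr ?_
    rintro _ ⟨B, hB, rfl⟩
    exact H B hB

end Monomials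

/-- The position of an exponent relative to the thresholds `q - 1` and `q`. -/
def level (q a : ℕ) : ℕ := if q ≤ a then 2 else if q - 1 ≤ a then 1 else 0

/-- The least exponent of a given level. -/
def levelMin (q l : ℕ) : ℕ := if l = 0 then 0 else if l = 1 then q - 1 else q

lemma level_levelMin {q l : ℕ} (hq : 2 ≤ q) (hl : l ≤ 2) : level q (levelMin q l) = l := by
  unfold level levelMin
  split_ifs <;> omega

lemma levelMin_le_iff {q l a : ℕ} (hq : 2 ≤ q) (hl : l ≤ 2) :
    levelMin q l ≤ a ↔ l ≤ level q a := by
  unfold level levelMin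
  split_ifs <;> omega

lemma levelMin_level {p a : ℕ} (hp : 2 ≤ p) (q : ℕ) (ha : a = 0 ∨ a = p - 1 ∨ a = p) :
    levelMin q (level p a) = if a = p then q else if a = p - 1 then q - 1 else 0 := by
  unfold level
  split_ifs <;> simp [levelMin] <;> omega

lemma level_le_two (q a : ℕ) : level q a ≤ 2 := by
  unfold level
  split_ifs <;> omega

lemma le_add_indicatorExp_iff {n q : ℕ} (hq : 2 ≤ q) (γ : Fin n → ℕ) (B : Finset (Fin n))
    (i : Fin n) : q ≤ γ i + indicatorExp B i ↔ 2 ≤ level q (γ i) + indicatorExp B i := by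
  unfold level indicatorExp
  split_ifs <;> omega

lemma isMinGen_levelMin_iff {k : Type*} [Field k] {n q : ℕ} (hq : 2 ≤ q)
    {J : Ideal (MvPowerSeries (Fin n) k)} {C : (Fin n → ℕ) → Prop}
    (hJ : ∀ γ, mon k γ ∈ J ↔ C (fun i => level q (γ i))) {l : Fin n → ℕ} (hl : ∀ i, l i ≤ 2) :
    IsMinGen k J (fun i => levelMin q (l i)) ↔
      C l ∧ ∀ l' : Fin n → ℕ, (∀ i, l' i ≤ l i) → l' ≠ l → ¬ C l' := by
  have hlev {l' : Fin n → ℕ} (h : ∀ i, l' i ≤ 2) :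
      mon k (fun i => levelMin q (l' i)) ∈ J ↔ C l' := by
    simp only [hJ, level_levelMin hq (h _)]
  rw [IsMinGen, hlev hl]
  refine and_congr_right fun _ => ⟨fun H l' hle hne hC => ?_, fun H δ hle hne hδ => ?_⟩
  · have hl' i : l' i ≤ 2 := (hle i).trans (hl i)
    refine H _ (fun i => ?_) (fun h => hne ?_) ((hlev hl').mpr hC)
    · rw [levelMin_le_iff hq (hl' i), level_levelMin hq (hl i)]
      exact hle i
    · funext i
      rw [← level_levelMin hq (hl' i), ← level_levelMin hq (hl i)]
      exact congrArg _ (congrFun h i)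
  · refine H _ (fun i => ?_) (fun h => hne ?_) ((hJ δ).mp hδ)
    · have h1 : levelMin q (level q (δ i)) ≤ levelMin q (l i) :=
        ((levelMin_le_iff hq (level_le_two _ _)).mpr le_rfl).trans (hle i)
      rwa [levelMin_le_iff hq (level_le_two _ _), level_levelMin hq (hl i)] at h1
    · funext i
      refine le_antisymm (hle i) ?_
      rw [levelMin_le_iff hq (hl i)]
      exact (congrFun h i).ge

theorem statement5 (p : ℕ) [Fact p.Prime] (k : Type*) [Field k] [CharP k p]
    (n : ℕ) (hn : 0 < n) (r : ℕ) (hr : 0 < r) (α : Fin r → Fin n → ℕ)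
    (I : Ideal (MvPowerSeries (Fin n) k)) (hdec : IsMinFaceDecomp k α I)
    (e : ℕ) (he : 1 ≤ e) (γ : Fin n → ℕ)
    (hγ01 : ∀ i, γ i = 0 ∨ γ i = p - 1 ∨ γ i = p) :
    IsMinGen k ((frobPow p I).colon I) γ ↔
      IsMinGen k ((frobPow (p ^ e) I).colon I) (scaleExp p (p ^ e) γ) := by
  obtain ⟨-, -, rfl, -⟩ := hdec
  have hp : 2 ≤ p := (Fact.out : p.Prime).two_le
  have hq {e : ℕ} (he : 1 ≤ e) : 2 ≤ p ^ e := hp.trans (Nat.le_self_pow (by omega) p)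
  have key {e : ℕ} (he : 1 ≤ e) := isMinGen_levelMin_iff (hq he)
    (J := (frobPow (p ^ e) (⨅ j, faceIdeal k (α j))).colon
      (⨅ j, faceIdeal k (α j) : Ideal (MvPowerSeries (Fin n) k)))
    (C := fun l => ∀ B, Hits α B → Hits α (Finset.univ.filter fun i => 2 ≤ l i + indicatorExp B i))
    (fun δ => by simp only [mon_mem_colon_iff, le_add_indicatorExp_iff (hq he)])
    (fun i => level_le_two p (γ i))
  have h1 : (fun i => levelMin p (level p (γ i))) = γ := by
    funext i
    have := hγ01 i
    rw [levelMin_level hp p this]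
    split_ifs <;> omega
  have h2 : (fun i => levelMin (p ^ e) (level p (γ i))) = scaleExp p (p ^ e) γ := by
    funext i
    exact levelMin_level hp _ (hγ01 i)
  have hkp := key le_rfl
  have hkq := key he
  rw [pow_one, h1] at hkp
  rw [h2] at hkq
  exact hkp.trans hkq.symm

end
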